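/- Let m : ℕ → ℕ with m i ≥ 2 for all i, let X = ∏_{i∈ℕ} Fin(m i), and let a group G act on X preserving firstDiff (firstDiff(g·x, g·y) = firstDiff(x, y) for all g ∈ G and all x ≠ y) and distance-transitively: for all x₁, x₂, y₁, y₂ ∈ X such that (x₁ = x₂ if and only if y₁ = y₂) and, in case x₁ ≠ x₂, firstDiff(x₁,x₂) = firstDiff(y₁,y₂), there exists g ∈ G with g·x₁ = y₁ and g·x₂ = y₂. Fix ξ ∈ X and n ∈ ℕ, and for x ∈ X define D(x) = n if x agrees with ξ in all coordinates i < n, and D(x) = firstDiff(x, ξ) otherwise. Then: (1) for all x, y ∈ X there exists g ∈ G such that g·ξ agrees with ξ in all coordinates i < n and g·x agrees with y in all coordinates i < n, if and only if D(x) = D(y); (2) for every k ≤ n there exists x ∈ X with D(x) = k. -/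

import Mathlib

open PiNat

namespace PiNat

variable {E : ℕ → Type*}

theorem forall_lt_eq_iff_le_firstDiff {x y : ∀ n, E n} (hne : x ≠ y) (k : ℕ) :
    (∀ i < k, x i = y i) ↔ k ≤ firstDiff x y :=
  mem_cylinder_iff_le_firstDiff hne k

/-- A group action preserving `firstDiff` preserves agreement on initial segments. -/
theorem forall_lt_smul_eq_iff {G : Type*} [Group G] [MulAction G (∀ n, E n)]
    (hpres : ∀ (g : G) (x y : ∀ n, E n), x ≠ y → firstDiff (g • x) (g • y) = firstDiff x y)
    (g : G) (x y : ∀ n, E n) (k : ℕ) :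
    (∀ i < k, (g • x) i = (g • y) i) ↔ ∀ i < k, x i = y i := by
  rcases eq_or_ne x y with rfl | hne
  · simp
  · rw [forall_lt_eq_iff_le_firstDiff ((MulAction.injective g).ne hne),
      forall_lt_eq_iff_le_firstDiff hne, hpres g x y hne]

theorem firstDiff_update_self (x : ∀ n, E n) {k : ℕ} {a : E k} (ha : a ≠ x k) :
    firstDiff (Function.update x k a) x = k := by
  have hne : Function.update x k a ≠ x := fun h => ha (by simpa using congrFun h k)
  refine le_antisymm ?_ ((forall_lt_eq_iff_le_firstDiff hne k).1 fun i hi => by simp [hi.ne])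
  by_contra! h
  exact ha (by simpa using apply_eq_of_lt_firstDiff h)

end PiNat

open Classical in
/-- Let `X = ∏ i, Fin (m i)` (each `m i ≥ 2`) and let a group `G` act on `X`
preserving `firstDiff` and distance-transitively.  Fix `ξ ∈ X` and `n ∈ ℕ`, and let
`D x = n` if `x` agrees with `ξ` in all coordinates `< n`, and `D x = firstDiff x ξ`
otherwise.  Then (1) two points `x, y` lie in the same orbit of the stabiliser of the level-`n`
vertex through `ξ` (acting on level-`n` vertices) if and only if `D x = D y`, and (2) every
value `k ≤ n` is attained by `D`. -/
theorem stabiliser_orbits_on_layer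
    (m : ℕ → ℕ) (hm : ∀ i, 2 ≤ m i)
    (G : Type*) [Group G] [MulAction G (∀ i : ℕ, Fin (m i))]
    (hpres : ∀ (g : G) (x y : ∀ i : ℕ, Fin (m i)), x ≠ y →
      firstDiff (g • x) (g • y) = firstDiff x y)
    (htrans : ∀ x₁ x₂ y₁ y₂ : ∀ i : ℕ, Fin (m i),
      (x₁ = x₂ ↔ y₁ = y₂) →
      (x₁ ≠ x₂ → firstDiff x₁ x₂ = firstDiff y₁ y₂) →
      ∃ g : G, g • x₁ = y₁ ∧ g • x₂ = y₂)
    (ξ : ∀ i : ℕ, Fin (m i)) (n : ℕ)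
    (D : (∀ i : ℕ, Fin (m i)) → ℕ)
    (hD : ∀ x, D x = if ∀ i < n, x i = ξ i then n else firstDiff x ξ) :
    (∀ x y : ∀ i : ℕ, Fin (m i),
        (∃ g : G, (∀ i < n, (g • ξ) i = ξ i) ∧ (∀ i < n, (g • x) i = y i)) ↔ D x = D y) ∧
      (∀ k ≤ n, ∃ x : ∀ i : ℕ, Fin (m i), D x = k) := by
  have hD_le (x) : D x ≤ n := by
    rw [hD]
    split_ifs with h
    · exact le_rfl
    · have hne : x ≠ ξ := fun e => h (by simp [e])
      rw [forall_lt_eq_iff_le_firstDiff hne] at h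
      omega
  have hle_D (x) (k) (hk : k ≤ n) : (∀ i < k, x i = ξ i) ↔ k ≤ D x := by
    rw [hD]
    split_ifs with h
    · exact iff_of_true (fun i hi => h i (hi.trans_le hk)) hk
    · exact forall_lt_eq_iff_le_firstDiff (fun e => h (by simp [e])) k
  refine ⟨fun x y => ⟨?_, fun h => ?_⟩, fun k hk => ?_⟩
  · rintro ⟨g, hξ, hx⟩
    have key (k) (hk : k ≤ n) : k ≤ D x ↔ k ≤ D y := by
      rw [← hle_D x k hk, ← hle_D y k hk, ← forall_lt_smul_eq_iff hpres g]
      refine forall₂_congr fun i hi => ?_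
      rw [hξ i (hi.trans_le hk), hx i (hi.trans_le hk)]
    exact le_antisymm ((key _ (hD_le x)).1 le_rfl) ((key _ (hD_le y)).2 le_rfl)
  · by_cases hx : ∀ i < n, x i = ξ i
    · have hy : ∀ i < n, y i = ξ i := by
        rwa [hle_D y n le_rfl, ← h, ← hle_D x n le_rfl]
      exact ⟨1, by simp, fun i hi => by rw [one_smul, hx i hi, hy i hi]⟩
    · have hy : ¬ ∀ i < n, y i = ξ i := by
        rwa [hle_D y n le_rfl, ← h, ← hle_D x n le_rfl]
      have hxne : x ≠ ξ := fun e => hx (by simp [e])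
      have hyne : y ≠ ξ := fun e => hy (by simp [e])
      rw [hD, hD, if_neg hx, if_neg hy] at h
      obtain ⟨g, hgx, hgξ⟩ := htrans x ξ y ξ (iff_of_false hxne hyne) fun _ => h
      exact ⟨g, fun i _ => by rw [hgξ], fun i _ => by rw [hgx]⟩
  · rcases hk.eq_or_lt with rfl | hk
    · exact ⟨ξ, by simp [hD]⟩
    · have : Nontrivial (Fin (m k)) := Fin.nontrivial_iff_two_le.2 (hm k)
      obtain ⟨a, ha⟩ := exists_ne (ξ k)
      refine ⟨Function.update ξ k a, ?_⟩
      rw [hD, if_neg fun h => ha (by simpa using h k hk), firstDiff_update_self ξ ha]
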